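/- Let B = diag(iω₁, -iω₁, ..., iω_p, -iω_p) acting on ℂ^{2p} (identified with ℝ^{2p} via the reality condition x̄_{2j} = x_{2j-1}). A smooth vector field f : ℂ^{2p} × ℝ^s → ℂ^{2p} respecting the reality condition is equivariant with respect to the torus action (x₁,x̄₁,...,x_p,x̄_p) ↦ (e^{iθ₁}x₁, e^{-iθ₁}x̄₁, ..., e^{iθ_p}x_p, e^{-iθ_p}x̄_p) for all (θ₁,...,θ_p) if and only if there exist smooth complex-valued functions a₁,...,a_p of (x₁x̄₁, ..., x_px̄_p, μ) such that the (2j-1)-th component of f is a_j(x₁x̄₁,...,x_px̄_p,μ)·x_j and the 2j-th component is its complex conjugate, for j = 1,...,p. -/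

import Mathlib

open Set Filter Topology MeasureTheory FourierTransform
open scoped ContDiff

/-- The powers of `s` are integrable against the weight `w`. -/
def HasAllMoments (w : ℝ → ℝ) : Prop :=
  ∀ k : ℕ, Integrable (fun s => s ^ k * w s)

/-- The even moments of the weight `w` are those of a unit mass at the imaginary unit. -/
def HasImaginaryMoments (w : ℝ → ℝ) : Prop :=
  HasAllMoments w ∧ ∀ n : ℕ, ∫ s, s ^ (2 * n) * w s = (-1) ^ n

lemma HasAllMoments.mul_id {w : ℝ → ℝ} (hw : HasAllMoments w) :
    HasAllMoments (fun s => s * w s) := fun k => by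
  simpa [pow_succ, mul_assoc] using hw (k + 1)

lemma HasAllMoments.integrable {w : ℝ → ℝ} (hw : HasAllMoments w) : Integrable w := by
  simpa using hw 0

lemma HasImaginaryMoments.integral_eq_one {w : ℝ → ℝ} (hw : HasImaginaryMoments w) :
    ∫ s, w s = 1 := by
  simpa using hw.2 0

lemma HasImaginaryMoments.neg_sq_mul {w : ℝ → ℝ} (hw : HasImaginaryMoments w) :
    HasImaginaryMoments (fun s => -(s ^ 2 * w s)) := by
  refine ⟨fun k => ?_, fun n => ?_⟩
  · have := (hw.1 (k + 2)).neg
    refine this.congr (Eventually.of_forall fun s => ?_)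
    simp only [Pi.neg_apply]
    ring
  · have := hw.2 (n + 1)
    rw [pow_succ, mul_neg_one] at this
    rw [← neg_inj, ← this, ← integral_neg]
    congr with s
    ring

lemma exists_schwartz_eventuallyEq {f : ℝ → ℂ} (hf : ContDiff ℝ ∞ f) :
    ∃ S : SchwartzMap ℝ ℂ, S =ᶠ[𝓝 0] f := by
  let χ : ContDiffBump (0 : ℝ) := ⟨1, 2, by norm_num, by norm_num⟩
  have hs : HasCompactSupport (fun x => χ x • f x) := χ.hasCompactSupport.smul_right
  refine ⟨hs.toSchwartzMap (χ.contDiff.smul hf), ?_⟩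
  filter_upwards [χ.eventuallyEq_one] with x hx
  simp [hx]

lemma iteratedDeriv_exp_real_mul (c : ℂ) (n : ℕ) :
    iteratedDeriv n (fun x : ℝ => Complex.exp (c * x)) =
      fun x : ℝ => c ^ n * Complex.exp (c * x) := by
  induction n with
  | zero => simp
  | succ n ih =>
    rw [iteratedDeriv_succ, ih]
    ext x
    have h : HasDerivAt (fun x : ℝ => Complex.exp (c * x)) (Complex.exp (c * x) * (c * 1)) x :=
      ((Complex.ofRealCLM.hasDerivAt (x := x)).const_mul c).cexp
    rw [(h.const_mul (c ^ n)).deriv]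
    ring

lemma exists_hasImaginaryMoments : ∃ w : ℝ → ℝ, HasImaginaryMoments w := by
  have hexp : ContDiff ℝ ∞ (fun x : ℝ => Complex.exp ((2 * Real.pi : ℂ) * x)) :=
    (contDiff_const.mul Complex.ofRealCLM.contDiff).cexp
  obtain ⟨S, hS⟩ := exists_schwartz_eventuallyEq hexp
  let W : SchwartzMap ℝ ℂ := 𝓕⁻ S
  have hW : 𝓕 (W : ℝ → ℂ) = S := by
    rw [← SchwartzMap.fourier_coe, FourierTransform.fourier_fourierInv_eq]
  have hint : ∀ n : ℕ, Integrable (fun x : ℝ => x ^ n • W x) := fun n => by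
    have h := W.integrable_pow_mul (volume : Measure ℝ) n
    refine h.mono' (by fun_prop) (Eventually.of_forall fun x => ?_)
    simp
  have hmom : ∀ n : ℕ, ∫ x : ℝ, x ^ (2 * n) • W x = (-1) ^ n := fun n => by
    have h1 := congrFun (Real.iteratedDeriv_fourier (f := W) (N := ⊤) (n := 2 * n)
      (fun n _ => hint n) le_top) 0
    rw [hW, hS.iteratedDeriv_eq, iteratedDeriv_exp_real_mul, Real.fourier_eq'] at h1
    simp only [Complex.ofReal_zero, mul_zero, zero_mul, Complex.exp_zero, mul_one, inner_zero_right,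
      one_smul] at h1
    have h2 : ∀ x : ℝ, (-2 * (Real.pi : ℂ) * Complex.I * x) ^ (2 * n) • W x
        = ((2 * Real.pi : ℂ) ^ (2 * n) * (-1) ^ n) * (x ^ (2 * n) • W x) := fun x => by
      have : (-2 * (Real.pi : ℂ) * Complex.I * x) ^ (2 * n)
          = (2 * Real.pi : ℂ) ^ (2 * n) * (-1) ^ n * (x : ℂ) ^ (2 * n) := by
        rw [pow_mul, pow_mul, pow_mul, ← mul_pow, ← mul_pow]
        congr 1
        linear_combination (4 * (Real.pi : ℂ) ^ 2 * x ^ 2) * Complex.I_sq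
      rw [this, smul_eq_mul, Complex.real_smul]
      push_cast
      ring
    simp only [h2] at h1
    rw [integral_const_mul] at h1
    have hne : (2 * Real.pi : ℂ) ^ (2 * n) ≠ 0 :=
      pow_ne_zero _ (by simp [Real.pi_ne_zero])
    have h3 : (-1 : ℂ) ^ n * ∫ x : ℝ, x ^ (2 * n) • W x = 1 := by
      apply mul_left_cancel₀ hne
      rw [← mul_assoc, ← h1, mul_one]
    have h4 : (-1 : ℂ) ^ n * (-1) ^ n = 1 := by rw [← mul_pow]; simp
    calc _ = ((-1 : ℂ) ^ n * (-1) ^ n) * ∫ x : ℝ, x ^ (2 * n) • W x := by rw [h4, one_mul]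
      _ = _ := by rw [mul_assoc, h3, mul_one]
  have hre : ∀ n : ℕ, (fun s : ℝ => s ^ n * (W s).re) = fun s => (s ^ n • W s).re := by
    intro n
    ext s
    rw [Complex.smul_re, smul_eq_mul]
  refine ⟨fun s => (W s).re, fun k => ?_, fun n => ?_⟩
  · rw [hre]
    exact (hint k).re
  · rw [hre]
    have h := integral_re (hint (2 * n))
    simp only [RCLike.re_eq_complex_re] at h
    rw [h, hmom, ← Complex.ofReal_one, ← Complex.ofReal_neg, ← Complex.ofReal_pow,
      Complex.ofReal_re]

lemma aestronglyMeasurable_dilation {E F : Type*} [NormedAddCommGroup E]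
    [NormedAddCommGroup F] [NormedSpace ℝ F] {w : ℝ → ℝ} {g : ℝ × E → F} (hw : HasAllMoments w)
    (hg : Continuous g) (x : ℝ × E) :
    AEStronglyMeasurable (fun s => w s • g (s * x.1, x.2)) :=
  hw.integrable.aestronglyMeasurable.smul
    (Continuous.aestronglyMeasurable (by fun_prop))

section Partials

universe u

variable {E F : Type u} [NormedAddCommGroup E] [NormedSpace ℝ E]
  [NormedAddCommGroup F] [NormedSpace ℝ F]

/-- The partial derivative in the real variable. -/
noncomputable def partialFst (g : ℝ × E → F) (x : ℝ × E) : F := fderiv ℝ g x (1, 0)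

/-- The partial derivative in the parameter. -/
noncomputable def partialSnd (g : ℝ × E → F) (x : ℝ × E) : E →L[ℝ] F :=
  (fderiv ℝ g x).comp (ContinuousLinearMap.inr ℝ ℝ E)

/-- The total derivative assembled from its two partial derivatives. -/
noncomputable def ofPartials : F × (E →L[ℝ] F) →L[ℝ] (ℝ × E →L[ℝ] F) :=
  (ContinuousLinearMap.smulRightL ℝ (ℝ × E) F (ContinuousLinearMap.fst ℝ ℝ E)).coprod
    ((ContinuousLinearMap.compL ℝ (ℝ × E) E F).flip (ContinuousLinearMap.snd ℝ ℝ E))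

@[simp] lemma ofPartials_apply (a : F) (b : E →L[ℝ] F) (x : ℝ × E) :
    ofPartials (a, b) x = x.1 • a + b x.2 := by
  simp [ofPartials]

lemma norm_ofPartials_le (a : F) (b : E →L[ℝ] F) : ‖ofPartials (a, b)‖ ≤ ‖a‖ + ‖b‖ := by
  refine ContinuousLinearMap.opNorm_le_bound _ (by positivity) fun x => ?_
  rw [ofPartials_apply, add_mul]
  refine norm_add_le_of_le ?_ ((b.le_opNorm _).trans ?_)
  · rw [norm_smul, mul_comm]
    gcongr
    exact norm_fst_le x
  · gcongr
    exact norm_snd_le x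

lemma fderiv_eq_ofPartials (g : ℝ × E → F) (x : ℝ × E) :
    fderiv ℝ g x = ofPartials (partialFst g x, partialSnd g x) := by
  ext v
  · simp [partialFst, partialSnd, Prod.mk_zero_zero]
  · simp [partialFst, partialSnd]

lemma partialFst_contDiff {g : ℝ × E → F} (hg : ContDiff ℝ ∞ g) :
    ContDiff ℝ ∞ (partialFst g) :=
  (hg.fderiv_right (m := ∞) (by simp)).clm_apply contDiff_const

lemma partialSnd_contDiff {g : ℝ × E → F} (hg : ContDiff ℝ ∞ g) :
    ContDiff ℝ ∞ (partialSnd g) :=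
  (hg.fderiv_right (m := ∞) (by simp)).clm_comp contDiff_const

lemma hasFDerivAt_ofPartials {g : ℝ × E → F} (hg : ContDiff ℝ ∞ g) (x : ℝ × E) :
    HasFDerivAt g (ofPartials (partialFst g x, partialSnd g x)) x := by
  rw [← fderiv_eq_ofPartials]
  exact (hg.differentiable (by simp) x).hasFDerivAt

lemma fderiv_eq_zero_of_lt_abs {g : ℝ × E → F} {R : ℝ}
    (h : ∀ t e, R < |t| → g (t, e) = 0) (t : ℝ) (e : E) (ht : R < |t|) :
    fderiv ℝ g (t, e) = 0 := by
  have : g =ᶠ[𝓝 (t, e)] fun _ => 0 := by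
    filter_upwards [(isOpen_lt continuous_const
      (continuous_abs.comp continuous_fst)).mem_nhds (show R < |(t, e).1| from ht)] with y hy
    exact h y.1 y.2 hy
  rw [this.fderiv_eq]
  simp

/-- The superposition of the dilates of `g` in the real variable with density `w`. -/
noncomputable def dilationIntegral (w : ℝ → ℝ) (g : ℝ × E → F) (x : ℝ × E) : F :=
  ∫ s, w s • g (s * x.1, x.2)

/-- Either the weight or the function has bounded support in the real variable. -/
def DilationAdmissible (w : ℝ → ℝ) (g : ℝ × E → F) : Prop :=
  ∃ R, (∀ s, R < |s| → w s = 0) ∨ (∀ t e, R < |t| → g (t, e) = 0)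

lemma DilationAdmissible.partialFst {w : ℝ → ℝ} {g : ℝ × E → F} (h : DilationAdmissible w g) :
    DilationAdmissible (fun s => s * w s) (partialFst g) := by
  obtain ⟨R, h | h⟩ := h
  · exact ⟨R, Or.inl fun s hs => by simp [h s hs]⟩
  · exact ⟨R, Or.inr fun t e ht => by simp [_root_.partialFst, fderiv_eq_zero_of_lt_abs h t e ht]⟩

lemma DilationAdmissible.partialSnd {w : ℝ → ℝ} {g : ℝ × E → F} (h : DilationAdmissible w g) :
    DilationAdmissible w (partialSnd g) := by
  obtain ⟨R, h | h⟩ := h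
  · exact ⟨R, Or.inl h⟩
  · exact ⟨R, Or.inr fun t e ht => by simp [_root_.partialSnd, fderiv_eq_zero_of_lt_abs h t e ht]⟩

variable [FiniteDimensional ℝ E]

lemma DilationAdmissible.exists_bound {w : ℝ → ℝ} {g : ℝ × E → F} (h : DilationAdmissible w g)
    (hg : Continuous g) (x₀ : ℝ × E) :
    ∃ C, ∀ s, ∀ x ∈ Metric.ball x₀ 1, ‖w s • g (s * x.1, x.2)‖ ≤ C * ‖w s‖ := by
  have : ProperSpace E := FiniteDimensional.proper ℝ E
  obtain ⟨R, h | h⟩ := h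
  · have hK : IsCompact (Icc (-R) R ×ˢ Metric.closedBall x₀ 1) :=
      isCompact_Icc.prod (isCompact_closedBall x₀ 1)
    obtain ⟨C, hC⟩ := hK.exists_bound_of_continuousOn
      (f := fun y : ℝ × (ℝ × E) => g (y.1 * y.2.1, y.2.2)) (by fun_prop)
    refine ⟨C, fun s x hx => ?_⟩
    by_cases hs : R < |s|
    · simp [h s hs]
    · rw [norm_smul, mul_comm]
      gcongr
      exact hC (s, x) ⟨abs_le.1 (not_lt.1 hs), Metric.ball_subset_closedBall hx⟩
  · have hK : IsCompact (Icc (-R) R ×ˢ Metric.closedBall x₀.2 1) :=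
      isCompact_Icc.prod (isCompact_closedBall x₀.2 1)
    obtain ⟨C, hC⟩ := hK.exists_bound_of_continuousOn hg.continuousOn
    refine ⟨max C 0, fun s x hx => ?_⟩
    rw [norm_smul, mul_comm]
    gcongr
    by_cases hs : R < |s * x.1|
    · simp [h _ _ hs]
    · refine (hC _ ⟨abs_le.1 (not_lt.1 hs), ?_⟩).trans (le_max_left _ _)
      rw [Metric.mem_closedBall]
      exact (le_max_right _ _).trans (Metric.mem_ball.1 hx).le

lemma DilationAdmissible.integrable {w : ℝ → ℝ} {g : ℝ × E → F} (h : DilationAdmissible w g)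
    (hw : HasAllMoments w) (hg : Continuous g) (x : ℝ × E) :
    Integrable (fun s => w s • g (s * x.1, x.2)) := by
  obtain ⟨C, hC⟩ := h.exists_bound hg x
  exact (hw.integrable.norm.const_mul C).mono' (aestronglyMeasurable_dilation hw hg x)
    (Eventually.of_forall fun s => hC s x (Metric.mem_ball_self one_pos))

lemma dilationIntegral_continuous {w : ℝ → ℝ} {g : ℝ × E → F} (hw : HasAllMoments w)
    (hg : Continuous g) (h : DilationAdmissible w g) : Continuous (dilationIntegral w g) := by
  refine continuous_iff_continuousAt.2 fun x => ?_
  obtain ⟨C, hC⟩ := h.exists_bound hg x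
  refine continuousAt_of_dominated (bound := fun s => C * ‖w s‖)
    (Eventually.of_forall fun y => aestronglyMeasurable_dilation hw hg y) ?_
    (hw.integrable.norm.const_mul C) (Eventually.of_forall fun s => ?_)
  · filter_upwards [Metric.ball_mem_nhds x one_pos] with y hy
    exact Eventually.of_forall fun s => hC s y hy
  · exact Continuous.continuousAt (by fun_prop)

lemma dilationIntegral_hasFDerivAt [CompleteSpace F] {w : ℝ → ℝ} {g : ℝ × E → F}
    (hw : HasAllMoments w) (hg : ContDiff ℝ ∞ g) (h : DilationAdmissible w g) (x : ℝ × E) :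
    HasFDerivAt (dilationIntegral w g)
      (ofPartials (dilationIntegral (fun s => s * w s) (partialFst g) x,
        dilationIntegral w (partialSnd g) x)) x := by
  have hg1 := (partialFst_contDiff hg).continuous
  have hg2 := (partialSnd_contDiff hg).continuous
  have i1 := h.partialFst.integrable hw.mul_id hg1
  have i2 := h.partialSnd.integrable hw hg2
  obtain ⟨C₁, hC₁⟩ := h.partialFst.exists_bound hg1 x
  obtain ⟨C₂, hC₂⟩ := h.partialSnd.exists_bound hg2 x
  let F' : ℝ × E → ℝ → F × (E →L[ℝ] F) := fun y s =>
    ((s * w s) • partialFst g (s * y.1, y.2), w s • partialSnd g (s * y.1, y.2))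
  have hF' : ∀ y, Integrable (F' y) := fun y => (i1 y).prodMk (i2 y)
  have hmeas : AEStronglyMeasurable (fun s => ofPartials (F' x s)) :=
    ofPartials.continuous.comp_aestronglyMeasurable (hF' x).aestronglyMeasurable
  have key : HasFDerivAt (dilationIntegral w g) (∫ s, ofPartials (F' x s)) x := by
    refine hasFDerivAt_integral_of_dominated_of_fderiv_le (Metric.ball_mem_nhds x one_pos)
      (F' := fun y s => ofPartials (F' y s))
      (bound := fun s => C₁ * ‖s * w s‖ + C₂ * ‖w s‖)
      (Eventually.of_forall fun y => aestronglyMeasurable_dilation hw hg.continuous y)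
      (h.integrable hw hg.continuous x)
      hmeas
      (Eventually.of_forall fun s y hy => ?_) ?_ (Eventually.of_forall fun s y _ => ?_)
    · exact (norm_ofPartials_le _ _).trans (add_le_add (hC₁ s y hy) (hC₂ s y hy))
    · exact (hw.mul_id.integrable.norm.const_mul C₁).add (hw.integrable.norm.const_mul C₂)
    · have hL : HasFDerivAt (fun y : ℝ × E => (s * y.1, y.2))
          ((s • ContinuousLinearMap.fst ℝ ℝ E).prod (ContinuousLinearMap.snd ℝ ℝ E)) y :=
        (hasFDerivAt_fst.const_mul s).prodMk hasFDerivAt_snd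
      have := ((hasFDerivAt_ofPartials hg (s * y.1, y.2)).comp y hL).const_smul (w s)
      refine this.congr_fderiv ?_
      ext v <;> simp [F', smul_smul, mul_comm]
  rw [ofPartials.integral_comp_comm (hF' x)] at key
  convert key using 2
  exact (integral_pair (i1 x) (i2 x)).symm

lemma dilationIntegral_contDiff_nat (n : ℕ) :
    ∀ {F : Type u} [NormedAddCommGroup F] [NormedSpace ℝ F] [CompleteSpace F]
      {w : ℝ → ℝ} {g : ℝ × E → F}, HasAllMoments w → ContDiff ℝ ∞ g → DilationAdmissible w g →
      ContDiff ℝ n (dilationIntegral w g) := by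
  induction n with
  | zero =>
    intro F _ _ _ w g hw hg h
    exact contDiff_zero.2 (dilationIntegral_continuous hw hg.continuous h)
  | succ n ih =>
    intro F _ _ _ w g hw hg h
    push_cast
    refine contDiff_succ_iff_hasFDerivAt.2
      ⟨_, ?_, fun x => dilationIntegral_hasFDerivAt hw hg h x⟩
    exact ofPartials.contDiff.comp ((ih hw.mul_id (partialFst_contDiff hg) h.partialFst).prodMk
      (ih hw (partialSnd_contDiff hg) h.partialSnd))

lemma dilationIntegral_contDiff [CompleteSpace F] {w : ℝ → ℝ} {g : ℝ × E → F}
    (hw : HasAllMoments w) (hg : ContDiff ℝ ∞ g) (h : DilationAdmissible w g) :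
    ContDiff ℝ ∞ (dilationIntegral w g) :=
  contDiff_infty.2 fun n => dilationIntegral_contDiff_nat n hw hg h

lemma exists_eq_smul_of_apply_zero [CompleteSpace F] {g : ℝ × E → F} (hg : ContDiff ℝ ∞ g)
    (h0 : ∀ e, g (0, e) = 0) :
    ∃ H : ℝ × E → F, ContDiff ℝ ∞ H ∧ ∀ t e, g (t, e) = t • H (t, e) := by
  let w : ℝ → ℝ := (Ioc 0 1).indicator fun _ => 1
  have hw : HasAllMoments w := fun k => by
    have h : IntegrableOn (fun s : ℝ => s ^ k) (Ioc 0 1) :=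
      ((continuous_pow k).integrableOn_Icc).mono_set Ioc_subset_Icc_self
    refine (h.integrable_indicator measurableSet_Ioc).congr (Eventually.of_forall fun s => ?_)
    by_cases hs : s ∈ Ioc (0 : ℝ) 1 <;> simp [w, hs]
  have hadm : DilationAdmissible w (partialFst g) := by
    refine ⟨1, Or.inl fun s hs => indicator_of_notMem (fun hs' => ?_) _⟩
    rw [abs_of_pos hs'.1] at hs
    exact hs.not_ge hs'.2
  refine ⟨dilationIntegral w (partialFst g),
    dilationIntegral_contDiff hw (partialFst_contDiff hg) hadm, fun t e => ?_⟩
  have hd : ∀ s : ℝ, HasDerivAt (fun s : ℝ => g (s * t, e)) (t • partialFst g (s * t, e)) s := by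
    intro s
    have hL : HasDerivAt (fun s : ℝ => (s * t, e)) (1 * t, 0) s :=
      ((hasDerivAt_id s).mul_const t).prodMk (hasDerivAt_const s e)
    have := (hasFDerivAt_ofPartials hg (s * t, e)).comp_hasDerivAt s hL
    simpa [Function.comp_def] using this
  have hc : Continuous fun s : ℝ => t • partialFst g (s * t, e) := by
    have := (partialFst_contDiff hg).continuous
    fun_prop
  have hI := intervalIntegral.integral_eq_sub_of_hasDerivAt (a := 0) (b := 1)
    (fun s _ => hd s) (hc.intervalIntegrable _ _)
  rw [one_mul, zero_mul, h0, sub_zero, intervalIntegral.integral_smul,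
    intervalIntegral.integral_of_le zero_le_one, ← integral_indicator measurableSet_Ioc] at hI
  rw [← hI, dilationIntegral]
  congr 2
  ext s
  by_cases hs : s ∈ Ioc (0 : ℝ) 1 <;> simp [w, hs]

omit [FiniteDimensional ℝ E] in
lemma fderiv_eq_comp_of_even {g : ℝ × E → F} (hg : ContDiff ℝ ∞ g)
    (he : ∀ t e, g (-t, e) = g (t, e)) (t : ℝ) (e : E) :
    fderiv ℝ g (t, e) = (fderiv ℝ g (-t, e)).comp
      ((-ContinuousLinearMap.fst ℝ ℝ E).prod (ContinuousLinearMap.snd ℝ ℝ E)) := by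
  have hN : HasFDerivAt (fun y : ℝ × E => (-y.1, y.2))
      ((-ContinuousLinearMap.fst ℝ ℝ E).prod (ContinuousLinearMap.snd ℝ ℝ E)) (t, e) :=
    hasFDerivAt_fst.neg.prodMk hasFDerivAt_snd
  have h := ((hg.differentiable (by simp) (-t, e)).hasFDerivAt).comp (t, e) hN
  rw [← h.fderiv]
  congr 1
  ext ⟨t, e⟩
  exact (he t e).symm

/-- Smooth functions, even and of bounded support in the real variable. -/
structure IsEvenSupported (g : ℝ × E → F) : Prop where
  contDiff : ContDiff ℝ ∞ g
  even : ∀ t e, g (-t, e) = g (t, e)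
  support : ∃ R, ∀ t e, R < |t| → g (t, e) = 0

omit [FiniteDimensional ℝ E] in
lemma IsEvenSupported.admissible {g : ℝ × E → F} (hg : IsEvenSupported g) (w : ℝ → ℝ) :
    DilationAdmissible w g :=
  hg.support.imp fun _ h => Or.inr h

omit [FiniteDimensional ℝ E] in
lemma IsEvenSupported.partialSnd {g : ℝ × E → F} (hg : IsEvenSupported g) :
    IsEvenSupported (partialSnd g) where
  contDiff := partialSnd_contDiff hg.contDiff
  even t e := by
    ext v
    simp [_root_.partialSnd, fderiv_eq_comp_of_even hg.contDiff hg.even t e]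
  support := hg.support.imp fun R h t e ht => by
    simp [_root_.partialSnd, fderiv_eq_zero_of_lt_abs h t e ht]

lemma IsEvenSupported.exists_partialFst_eq [CompleteSpace F] {g : ℝ × E → F}
    (hg : IsEvenSupported g) :
    ∃ g₁ : ℝ × E → F, IsEvenSupported g₁ ∧ ∀ t e, partialFst g (t, e) = (2 * t) • g₁ (t, e) := by
  have hodd : ∀ t e, partialFst g (-t, e) = -partialFst g (t, e) := fun t e => by
    rw [partialFst, partialFst, fderiv_eq_comp_of_even hg.contDiff hg.even t e]
    simp [← map_neg]
  obtain ⟨H, hH, hHg⟩ := exists_eq_smul_of_apply_zero (partialFst_contDiff hg.contDiff)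
    fun e => by
      have := hodd 0 e
      rw [neg_zero, eq_neg_iff_add_eq_zero, ← two_smul ℝ] at this
      exact (smul_eq_zero.1 this).resolve_left two_ne_zero
  refine ⟨fun x => (2⁻¹ : ℝ) • H x, ⟨hH.const_smul _, fun t e => ?_, ?_⟩, fun t e => ?_⟩
  · rcases eq_or_ne t 0 with rfl | ht
    · simp
    · have := hodd t e
      rw [hHg, hHg, neg_smul, neg_inj] at this
      rw [smul_right_injective F ht this]
  · obtain ⟨R, hR⟩ := hg.support
    refine ⟨max R 0, fun t e ht => ?_⟩
    have ht0 : t ≠ 0 := abs_pos.1 ((le_max_right _ _).trans_lt ht)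
    have h := hHg t e
    rw [partialFst, fderiv_eq_zero_of_lt_abs hR t e ((le_max_left _ _).trans_lt ht)] at h
    have h' : H (t, e) = 0 := (smul_eq_zero.1 h.symm).resolve_left ht0
    simp [h']
  · rw [hHg, smul_smul]
    congr 1
    ring

omit [FiniteDimensional ℝ E] in
lemma hasFDerivAt_of_hasFDerivAt_of_fst_ne_zero {A : ℝ × E → F} {Φ : ℝ × E → (ℝ × E →L[ℝ] F)}
    (hA : Continuous A) (hΦ : Continuous Φ) (h : ∀ x : ℝ × E, x.1 ≠ 0 → HasFDerivAt A (Φ x) x)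
    (x : ℝ × E) : HasFDerivAt A (Φ x) x := by
  have key : ∀ I : Set ℝ, IsOpen I → Convex ℝ I → (0 : ℝ) ∉ I →
      HasFDerivWithinAt A (Φ x) (closure (I ×ˢ (univ : Set E))) x := by
    intro I hIo hIc hI0
    have hd : ∀ y ∈ I ×ˢ (univ : Set E), HasFDerivAt A (Φ y) y := fun y hy =>
      h y fun h0 => hI0 (h0 ▸ hy.1)
    refine hasFDerivWithinAt_closure_of_tendsto_fderiv
      (fun y hy => (hd y hy).differentiableAt.differentiableWithinAt) (hIc.prod convex_univ)
      (hIo.prod isOpen_univ) (fun y _ => hA.continuousWithinAt) ?_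
    refine (hΦ.continuousWithinAt (s := I ×ˢ (univ : Set E))).congr' ?_
    filter_upwards [self_mem_nhdsWithin] with y hy
    exact (hd y hy).fderiv.symm
  have hunion := (key (Ioi 0) isOpen_Ioi (convex_Ioi 0) (by simp)).union
    (key (Iio 0) isOpen_Iio (convex_Iio 0) (by simp))
  rw [closure_prod_eq, closure_prod_eq, closure_Ioi, closure_Iio, closure_univ, ← union_prod,
    Ici_union_Iic, univ_prod_univ] at hunion
  exact hasFDerivWithinAt_univ.1 hunion

/-- For an even `g` in the real variable, a function whose value at `(t ^ 2, e)` is `g (t, e)`;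
for negative first argument, the dilates of `g` are superposed with density `w`. -/
noncomputable def evenSqrtExtension (w : ℝ → ℝ) (g : ℝ × E → F) (x : ℝ × E) : F :=
  g (√x.1, x.2) + dilationIntegral w g (√(-x.1), x.2) - g (0, x.2)

omit [NormedAddCommGroup E] [NormedSpace ℝ E] [FiniteDimensional ℝ E] in
lemma dilationIntegral_zero_fst [CompleteSpace F] {w : ℝ → ℝ} (hw : HasImaginaryMoments w) (g : ℝ × E → F) (e : E) :
    dilationIntegral w g (0, e) = g (0, e) := by
  simp only [dilationIntegral, mul_zero]
  rw [integral_smul_const, hw.integral_eq_one, one_smul]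

omit [NormedAddCommGroup E] [NormedSpace ℝ E] [FiniteDimensional ℝ E] in
lemma evenSqrtExtension_of_nonneg [CompleteSpace F] {w : ℝ → ℝ} (hw : HasImaginaryMoments w)
    (g : ℝ × E → F) {x : ℝ × E} (hx : 0 ≤ x.1) : evenSqrtExtension w g x = g (√x.1, x.2) := by
  simp [evenSqrtExtension, Real.sqrt_eq_zero_of_nonpos (neg_nonpos.2 hx),
    dilationIntegral_zero_fst hw]

omit [NormedAddCommGroup E] [NormedSpace ℝ E] [FiniteDimensional ℝ E] in
lemma evenSqrtExtension_of_nonpos (w : ℝ → ℝ) (g : ℝ × E → F) {x : ℝ × E} (hx : x.1 ≤ 0) :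
    evenSqrtExtension w g x = dilationIntegral w g (√(-x.1), x.2) := by
  simp [evenSqrtExtension, Real.sqrt_eq_zero_of_nonpos hx]

lemma evenSqrtExtension_continuous {w : ℝ → ℝ} {g : ℝ × E → F} (hw : HasAllMoments w)
    (hg : IsEvenSupported g) : Continuous (evenSqrtExtension w g) := by
  have h1 := hg.contDiff.continuous
  have h2 := dilationIntegral_continuous hw h1 (hg.admissible w)
  unfold evenSqrtExtension
  fun_prop

lemma evenSqrtExtension_hasFDerivAt [CompleteSpace F] {w : ℝ → ℝ} {g g₁ : ℝ × E → F}
    (hw : HasImaginaryMoments w) (hg : IsEvenSupported g) (hg₁ : IsEvenSupported g₁)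
    (h : ∀ t e, partialFst g (t, e) = (2 * t) • g₁ (t, e)) (x : ℝ × E) :
    HasFDerivAt (evenSqrtExtension w g)
      (ofPartials (evenSqrtExtension (fun s => -(s ^ 2 * w s)) g₁ x,
        evenSqrtExtension w (partialSnd g) x)) x := by
  refine hasFDerivAt_of_hasFDerivAt_of_fst_ne_zero
    (Φ := fun x => ofPartials (evenSqrtExtension (fun s => -(s ^ 2 * w s)) g₁ x,
        evenSqrtExtension w (partialSnd g) x)) (evenSqrtExtension_continuous hw.1 hg)
    (ofPartials.continuous.comp ((evenSqrtExtension_continuous hw.neg_sq_mul.1 hg₁).prodMk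
      (evenSqrtExtension_continuous hw.1 hg.partialSnd))) (fun x hx => ?_) x
  rcases hx.lt_or_gt with hx | hx
  · have hev : evenSqrtExtension w g =ᶠ[𝓝 x]
        fun y => dilationIntegral w g (√(-y.1), y.2) := by
      filter_upwards [(isOpen_lt continuous_fst continuous_const).mem_nhds hx] with y hy
      exact evenSqrtExtension_of_nonpos w g (le_of_lt hy)
    refine HasFDerivAt.congr_of_eventuallyEq ?_ hev
    have hr : 0 < √(-x.1) := Real.sqrt_pos.2 (neg_pos.2 hx)
    have hL : HasFDerivAt (fun y : ℝ × E => (√(-y.1), y.2)) _ x :=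
      (hasFDerivAt_fst.neg.sqrt (neg_pos.2 hx).ne').prodMk hasFDerivAt_snd
    have hmain := (dilationIntegral_hasFDerivAt hw.1 hg.contDiff (hg.admissible w)
      (√(-x.1), x.2)).comp x hL
    refine hmain.congr_fderiv ?_
    have hJ : dilationIntegral (fun s => s * w s) (partialFst g) (√(-x.1), x.2)
        = -((2 * √(-x.1)) • dilationIntegral (fun s => -(s ^ 2 * w s)) g₁ (√(-x.1), x.2)) := by
      simp only [dilationIntegral]
      rw [← integral_smul, ← integral_neg]
      congr with s
      rw [h, smul_smul, smul_smul, ← neg_smul]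
      congr 1
      ring
    simp only [evenSqrtExtension_of_nonpos _ _ hx.le, hJ]
    ext v
    · simp [smul_smul]
      field_simp
      simp
    · simp
  · have hev : evenSqrtExtension w g =ᶠ[𝓝 x] fun y => g (√y.1, y.2) := by
      filter_upwards [(isOpen_lt continuous_const continuous_fst).mem_nhds hx] with y hy
      exact evenSqrtExtension_of_nonneg hw g (le_of_lt hy)
    refine HasFDerivAt.congr_of_eventuallyEq ?_ hev
    have hr : 0 < √x.1 := Real.sqrt_pos.2 hx
    have hL : HasFDerivAt (fun y : ℝ × E => (√y.1, y.2)) _ x :=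
      (hasFDerivAt_fst.sqrt hx.ne').prodMk hasFDerivAt_snd
    have hmain := (hasFDerivAt_ofPartials hg.contDiff (√x.1, x.2)).comp x hL
    refine hmain.congr_fderiv ?_
    rw [evenSqrtExtension_of_nonneg hw _ hx.le,
      evenSqrtExtension_of_nonneg hw.neg_sq_mul _ hx.le, h]
    ext v
    · simp [smul_smul]
      field_simp
      simp
    · simp

lemma evenSqrtExtension_contDiff_nat (n : ℕ) :
    ∀ {F : Type u} [NormedAddCommGroup F] [NormedSpace ℝ F] [CompleteSpace F]
      {w : ℝ → ℝ} {g : ℝ × E → F}, HasImaginaryMoments w → IsEvenSupported g →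
      ContDiff ℝ n (evenSqrtExtension w g) := by
  induction n with
  | zero =>
    intro F _ _ _ w g hw hg
    exact contDiff_zero.2 (evenSqrtExtension_continuous hw.1 hg)
  | succ n ih =>
    intro F _ _ _ w g hw hg
    obtain ⟨g₁, hg₁, h⟩ := hg.exists_partialFst_eq
    push_cast
    refine contDiff_succ_iff_hasFDerivAt.2
      ⟨_, ?_, evenSqrtExtension_hasFDerivAt hw hg hg₁ h⟩
    exact ofPartials.contDiff.comp ((ih hw.neg_sq_mul hg₁).prodMk (ih hw hg.partialSnd))

lemma evenSqrtExtension_contDiff [CompleteSpace F] {w : ℝ → ℝ} {g : ℝ × E → F}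
    (hw : HasImaginaryMoments w) (hg : IsEvenSupported g) :
    ContDiff ℝ ∞ (evenSqrtExtension w g) :=
  contDiff_infty.2 fun n => evenSqrtExtension_contDiff_nat n hw hg

/-- **Whitney's theorem on even functions**, with parameters: a smooth even function of a real
variable is a smooth function of the square, through a construction that acts separately on each
value of the parameter. -/
theorem exists_contDiff_comp_sq [CompleteSpace F] {g : ℝ × E → F} (hg : ContDiff ℝ ∞ g)
    (he : ∀ t e, g (-t, e) = g (t, e)) :
    ∃ b : ℝ × E → F, ContDiff ℝ ∞ b ∧ (∀ t e, b (t ^ 2, e) = g (t, e)) ∧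
      ∀ e e', (∀ t, g (t, e) = g (t, e')) → ∀ u, b (u, e) = b (u, e') := by
  obtain ⟨w, hw⟩ := exists_hasImaginaryMoments
  let χ : ContDiffBump (0 : ℝ) := ⟨1, 2, by norm_num, by norm_num⟩
  let g₀ : ℝ × E → F := fun x => χ x.1 • g x
  have hg₀ : IsEvenSupported g₀ := by
    refine ⟨(χ.contDiff.comp contDiff_fst).smul hg, fun t e => ?_, 2, fun t e ht => ?_⟩
    · simp only [g₀, he, χ.neg]
    · simp only [g₀]
      rw [χ.zero_of_le_dist (by simpa using ht.le), zero_smul]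
  have hzero : ∀ u : ℝ, u < 1 → χ (√u) = 1 := fun u hu => by
    refine χ.one_of_mem_closedBall ?_
    rw [mem_closedBall_zero_iff, Real.norm_of_nonneg (Real.sqrt_nonneg u)]
    exact Real.sqrt_le_one.2 hu.le
  let k : ℝ × E → F := fun x => (1 - χ (√x.1)) • g (√x.1, x.2)
  have hk : ContDiff ℝ ∞ k := by
    refine contDiff_iff_contDiffAt.2 fun x => ?_
    rcases lt_or_ge x.1 1 with hx | hx
    · have : k =ᶠ[𝓝 x] fun _ => 0 := by
        filter_upwards [(isOpen_lt continuous_fst continuous_const).mem_nhds hx] with y hy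
        simp [k, hzero y.1 hy]
      exact contDiffAt_const.congr_of_eventuallyEq this
    · have hs : ContDiffAt ℝ ∞ (fun y : ℝ × E => √y.1) x :=
        contDiffAt_fst.sqrt (by linarith)
      exact (contDiffAt_const.sub (χ.contDiff.contDiffAt.comp x hs)).smul
        (hg.contDiffAt.comp x (hs.prodMk contDiffAt_snd))
  refine ⟨fun x => evenSqrtExtension w g₀ x + k x,
    (evenSqrtExtension_contDiff hw hg₀).add hk, fun t e => ?_, fun e e' hee u => ?_⟩
  · have habs : ∀ t e, g (|t|, e) = g (t, e) := fun t e => by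
      rcases abs_choice t with h | h <;> simp [h, he]
    simp only [evenSqrtExtension_of_nonneg hw g₀ (x := (t ^ 2, e)) (sq_nonneg t), k, g₀,
      Real.sqrt_sq_eq_abs, habs, ← add_smul]
    simp
  · simp only [evenSqrtExtension, dilationIntegral, k, g₀, hee]

end Partials

section Coordinates

variable {p s : ℕ}

lemma contDiff_update_fst (i : Fin p) :
    ContDiff ℝ ∞ fun x : ℝ × ((Fin p → ℝ) × (Fin s → ℝ)) =>
      (Function.update x.2.1 i x.1, x.2.2) := by
  refine ContDiff.prodMk (contDiff_pi.2 fun j => ?_) (by fun_prop)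
  rcases eq_or_ne j i with rfl | hj
  · simpa using contDiff_fst
  · simp only [Function.update_of_ne hj]
    fun_prop

/-- Invariance under the reflection of one coordinate. -/
def IsEvenInCoord (i : Fin p) (g : (Fin p → ℝ) × (Fin s → ℝ) → ℂ) : Prop :=
  ∀ x μ, g (Function.update x i (-x i), μ) = g (x, μ)

lemma exists_comp_sq_coord (i : Fin p) {g : (Fin p → ℝ) × (Fin s → ℝ) → ℂ}
    (hg : ContDiff ℝ ∞ g) (hi : IsEvenInCoord i g) :
    ∃ b : (Fin p → ℝ) × (Fin s → ℝ) → ℂ, ContDiff ℝ ∞ b ∧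
      (∀ x μ, b (Function.update x i (x i ^ 2), μ) = g (x, μ)) ∧
      ∀ j, j ≠ i → IsEvenInCoord j g → IsEvenInCoord j b := by
  obtain ⟨b, hb, hbg, hdep⟩ := exists_contDiff_comp_sq (hg.comp (contDiff_update_fst i))
    fun t e => by simpa using hi (Function.update e.1 i t) e.2
  refine ⟨fun y => b (y.1 i, y), hb.comp (ContDiff.prodMk (by fun_prop) contDiff_id),
    fun x μ => ?_, fun j hj hgj x μ => ?_⟩
  · simp [hbg]
  · simp only [Function.update_of_ne hj.symm]
    refine hdep _ _ (fun t => ?_) _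
    have := hgj (Function.update x i t) μ
    rw [Function.update_of_ne hj] at this
    simpa [Function.update_comm hj] using this

lemma exists_comp_sq_finset (S : Finset (Fin p)) {g : (Fin p → ℝ) × (Fin s → ℝ) → ℂ}
    (hg : ContDiff ℝ ∞ g) (he : ∀ i, IsEvenInCoord i g) :
    ∃ a : (Fin p → ℝ) × (Fin s → ℝ) → ℂ, ContDiff ℝ ∞ a ∧
      (∀ x μ, a (fun i => if i ∈ S then x i ^ 2 else x i, μ) = g (x, μ)) ∧
      ∀ i ∉ S, IsEvenInCoord i a := by
  induction S using Finset.induction_on with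
  | empty => exact ⟨g, hg, by simp, fun i _ => he i⟩
  | insert i S hi ih =>
    obtain ⟨a, ha, hag, hae⟩ := ih
    obtain ⟨b, hb, hba, hbe⟩ := exists_comp_sq_coord i ha (hae i hi)
    refine ⟨b, hb, fun x μ => ?_, fun j hj => ?_⟩
    · rw [← hag, ← hba]
      congr 2
      ext j
      rcases eq_or_ne j i with rfl | hj
      · simp [hi]
      · simp [hj]
    · rw [Finset.mem_insert, not_or] at hj
      exact hbe j hj.1 (hae j hj.2)

lemma exists_comp_sq {g : (Fin p → ℝ) × (Fin s → ℝ) → ℂ}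
    (hg : ContDiff ℝ ∞ g) (he : ∀ i, IsEvenInCoord i g) :
    ∃ a : (Fin p → ℝ) × (Fin s → ℝ) → ℂ, ContDiff ℝ ∞ a ∧
      ∀ x μ, a (fun i => x i ^ 2, μ) = g (x, μ) := by
  obtain ⟨a, ha, hag, -⟩ := exists_comp_sq_finset Finset.univ hg he
  exact ⟨a, ha, by simpa using hag⟩

lemma eq_of_smul_eq_smul {k l : ℝ → ℂ} (hk : Continuous k) (hl : Continuous l)
    (h : ∀ t, t • k t = t • l t) : k = l :=
  hk.ext_on (dense_compl_singleton (0 : ℝ)) hl fun t ht => smul_right_injective ℂ ht (h t)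

lemma exists_eq_coord_smul (j : Fin p) {h : (Fin p → ℝ) × (Fin s → ℝ) → ℂ}
    (hh : ContDiff ℝ ∞ h) (hodd : ∀ x μ, h (Function.update x j (-x j), μ) = -h (x, μ))
    (heven : ∀ i, i ≠ j → IsEvenInCoord i h) :
    ∃ g : (Fin p → ℝ) × (Fin s → ℝ) → ℂ, ContDiff ℝ ∞ g ∧ (∀ i, IsEvenInCoord i g) ∧
      ∀ x μ, h (x, μ) = x j • g (x, μ) := by
  have hodd' : ∀ x μ t, h (Function.update x j (-t), μ) = -h (Function.update x j t, μ) :=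
    fun x μ t => by simpa using hodd (Function.update x j t) μ
  obtain ⟨H, hH, hHh⟩ := exists_eq_smul_of_apply_zero (hh.comp (contDiff_update_fst j))
    fun e => by
      have := hodd' e.1 e.2 0
      rw [neg_zero, self_eq_neg] at this
      simpa using this
  simp only [Function.comp_apply] at hHh
  have hcont : ∀ e, Continuous fun t => H (t, e) := fun e => by
    have := hH.continuous
    fun_prop
  refine ⟨fun y => H (y.1 j, y), hH.comp (ContDiff.prodMk (by fun_prop) contDiff_id),
    fun i x μ => ?_, fun x μ => ?_⟩
  · rcases eq_or_ne i j with rfl | hi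
    · have := eq_of_smul_eq_smul (k := fun t => H (-t, (Function.update x i (-x i), μ)))
        (l := fun t => H (t, (x, μ))) ((hcont _).comp continuous_neg) (hcont _) fun t => by
          rw [← neg_inj, ← neg_smul, ← hHh, ← hHh]
          simp [hodd']
      simpa using congrFun this (x i)
    · have := eq_of_smul_eq_smul (k := fun t => H (t, (Function.update x i (-x i), μ)))
        (l := fun t => H (t, (x, μ))) (hcont _) (hcont _) fun t => by
          rw [← hHh, ← hHh]
          have := heven i hi (Function.update x j t) μ
          rw [Function.update_of_ne hi] at this
          simpa [Function.update_comm hi] using this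
      simpa [Function.update_of_ne hi.symm] using congrFun this (x j)
  · simpa using hHh (x j) (x, μ)

end Coordinates


/-- Torus-equivariant normal form (case `κ = 2p`): writing `ℂ^{2p}` with the reality
condition in the reduced coordinates `z = (x₁,...,x_p)` (the conjugate components
`x̄_j` being determined), a smooth vector field `f : ℂ^p × ℝ^s → ℂ^p` is equivariant
with respect to the torus action `x_j ↦ e^{iθ_j} x_j` if and only if there are smooth
complex-valued functions `a_j` of the invariants `(x₁x̄₁,...,x_px̄_p, μ)` with
`f_j(z,μ) = a_j(|z₁|²,...,|z_p|²,μ) · z_j`. -/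
theorem stmt15 (p s : ℕ) (f : ((Fin p → ℂ) × (Fin s → ℝ)) → (Fin p → ℂ))
    (hf : ContDiff ℝ (⊤ : ℕ∞) f) :
    (∀ (θ : Fin p → ℝ) (z : Fin p → ℂ) (μ : Fin s → ℝ) (j : Fin p),
        f (fun i => Complex.exp (Complex.I * θ i) * z i, μ) j
          = Complex.exp (Complex.I * θ j) * f (z, μ) j)
    ↔ ∃ a : Fin p → (((Fin p → ℝ) × (Fin s → ℝ)) → ℂ),
        (∀ j, ContDiff ℝ (⊤ : ℕ∞) (a j)) ∧
        ∀ (z : Fin p → ℂ) (μ : Fin s → ℝ) (j : Fin p),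
          f (z, μ) j = a j (fun i => Complex.normSq (z i), μ) * z j := by
  constructor
  · intro h
    have hreal : ContDiff ℝ ∞ fun y : (Fin p → ℝ) × (Fin s → ℝ) =>
        f (fun i => (y.1 i : ℂ), y.2) := by
      refine hf.comp (ContDiff.prodMk (contDiff_pi.2 fun i => ?_) contDiff_snd)
      exact Complex.ofRealCLM.contDiff.comp (by fun_prop)
    have hreflect : ∀ (i j : Fin p) (x : Fin p → ℝ) (μ : Fin s → ℝ),
        f (fun k => (Function.update x i (-x i) k : ℂ), μ) j
          = (if j = i then -1 else 1) * f (fun k => (x k : ℂ), μ) j := by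
      intro i j x μ
      have hexp : ∀ k : Fin p,
          Complex.exp (Complex.I * (Function.update (0 : Fin p → ℝ) i Real.pi k : ℝ))
            = if k = i then -1 else 1 := by
        intro k
        rcases eq_or_ne k i with rfl | hk
        · simp [mul_comm Complex.I, Complex.exp_pi_mul_I]
        · simp [hk]
      have := h (Function.update 0 i Real.pi) (fun k => (x k : ℂ)) μ j
      simp only [hexp] at this
      rw [← this]
      congr 2
      ext k
      rcases eq_or_ne k i with rfl | hk
      · simp
      · simp [hk]
    have key : ∀ j : Fin p, ∃ a : ((Fin p → ℝ) × (Fin s → ℝ)) → ℂ, ContDiff ℝ ∞ a ∧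
        ∀ (x : Fin p → ℝ) (μ : Fin s → ℝ),
          f (fun k => (x k : ℂ), μ) j = x j * a (fun i => x i ^ 2, μ) := by
      intro j
      obtain ⟨g, hg, hge, hgf⟩ := exists_eq_coord_smul j (contDiff_pi.1 hreal j)
        (fun x μ => by simp only [hreflect]; simp)
        (fun i hi x μ => by simp only [hreflect]; simp [hi.symm])
      obtain ⟨a, ha, hag⟩ := exists_comp_sq hg hge
      exact ⟨a, ha, fun x μ => by rw [hag, hgf, Complex.real_smul]⟩
    choose a ha hfa using key
    refine ⟨a, ha, fun z μ j => ?_⟩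
    have hpolar : ∀ i, Complex.exp (Complex.I * (z i).arg) * (‖z i‖ : ℝ) = z i := fun i => by
      rw [mul_comm, mul_comm Complex.I, Complex.norm_mul_exp_arg_mul_I]
    have hz := h (fun i => (z i).arg) (fun i => (‖z i‖ : ℂ)) μ j
    simp only [hpolar] at hz
    simp only [Complex.normSq_eq_norm_sq]
    rw [hz, hfa j (fun i => ‖z i‖) μ, ← mul_assoc, hpolar, mul_comm]
  · rintro ⟨a, -, hfa⟩ θ z μ j
    have hnorm : ∀ i, Complex.normSq (Complex.exp (Complex.I * θ i) * z i)
        = Complex.normSq (z i) := fun i => by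
      rw [map_mul, Complex.normSq_eq_norm_sq (Complex.exp _), mul_comm Complex.I,
        Complex.norm_exp_ofReal_mul_I, one_pow, one_mul]
    simp only [hfa, hnorm]
    ring
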